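/- Let G be a finite abelian group and let S be a sequence over G with 0 not a term of S, |S| ≥ D(G), and 0 ∈ E(S). If a is a term of some nonempty zero-sum subsequence T of S, then E(S) + {0, −a} ⊆ E(S·a^{-1}), i.e., for every h ∈ E(S), both h and h − a belong to E(S·a^{-1}), where S·a^{-1} is S with one copy of a removed. -/

import Mathlib

/-- `NSub S g` is the number of subsequences (sub-multisets, counted with the
multiplicity of their appearance in `S`) of the sequence `S` with sum `g`. -/
def NSub {G : Type*} [AddCommGroup G] [DecidableEq G] (S : Multiset G) (g : G) : ℕ :=
  (S.powerset.filter (fun T => T.sum = g)).card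

/-- The Davenport constant of `G`: the smallest positive integer `ℓ` such that every
sequence over `G` of length at least `ℓ` has a nonempty zero-sum subsequence. -/
noncomputable def Davenport (G : Type*) [AddCommGroup G] : ℕ :=
  sInf {ℓ : ℕ | 0 < ℓ ∧ ∀ S : Multiset G, ℓ ≤ Multiset.card S →
    ∃ T : Multiset G, T ≤ S ∧ T ≠ 0 ∧ T.sum = 0}

/-- `ESet S = {g ∈ G : N_g(S) = 2 ^ (|S| - D(G) + 1)}`. -/
def ESet {G : Type*} [AddCommGroup G] [DecidableEq G] (S : Multiset G) : Set G :=
  {g | NSub S g = 2 ^ (Multiset.card S + 1 - Davenport G)}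

/-- A minimal zero-sum sequence: nonempty, zero-sum, and every nonempty proper
subsequence has nonzero sum. -/
def IsMinZeroSum {G : Type*} [AddCommGroup G] (T : Multiset G) : Prop :=
  T ≠ 0 ∧ T.sum = 0 ∧ ∀ U : Multiset G, U ≤ T → U ≠ 0 → U ≠ T → U.sum ≠ 0

section SubsequenceCounts

variable {G : Type*} [AddCommGroup G]

/-- Every sequence of length at least `|G|` has a nonempty zero-sum subsequence. -/
theorem exists_zero_sum_of_card_le [Fintype G] (S : Multiset G)
    (hS : Fintype.card G ≤ Multiset.card S) :
    ∃ T : Multiset G, T ≤ S ∧ T ≠ 0 ∧ T.sum = 0 := by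
  induction S using Quotient.inductionOn with | _ l
  have hl : Fintype.card G ≤ l.length := by simpa using hS
  obtain ⟨i, j, hij, hsum⟩ := Fintype.exists_ne_map_eq_of_card_lt
    (fun i : Fin (l.length + 1) => (l.take i).sum) (by simpa using Nat.lt_succ_of_le hl)
  wlog hlt : i < j generalizing i j
  · exact this j i hij.symm hsum.symm (lt_of_le_of_ne (not_lt.mp hlt) hij.symm)
  refine ⟨((l.take j).drop i : List G), ?_, ?_, ?_⟩
  · exact ((List.drop_sublist _ _).trans (List.take_sublist _ _)).subperm
  · have hj := j.isLt
    have hlt' : (i : ℕ) < j := hlt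
    rw [← Multiset.card_pos, Multiset.coe_card, List.length_drop, List.length_take]
    omega
  · have h := List.sum_take_add_sum_drop (l.take j) i
    rw [List.take_take, min_eq_left (Fin.le_def.mp hlt.le), hsum] at h
    simpa using h

theorem davenport_spec (G : Type*) [AddCommGroup G] [Fintype G] :
    0 < Davenport G ∧ ∀ S : Multiset G, Davenport G ≤ Multiset.card S →
      ∃ T : Multiset G, T ≤ S ∧ T ≠ 0 ∧ T.sum = 0 :=
  Nat.sInf_mem (s := {ℓ : ℕ | 0 < ℓ ∧ ∀ S : Multiset G, ℓ ≤ Multiset.card S →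
    ∃ T : Multiset G, T ≤ S ∧ T ≠ 0 ∧ T.sum = 0})
    ⟨Fintype.card G, Fintype.card_pos, exists_zero_sum_of_card_le⟩

variable [DecidableEq G]

theorem nSub_cons (S : Multiset G) (a g : G) :
    NSub (a ::ₘ S) g = NSub S g + NSub S (g - a) := by
  simp only [NSub, Multiset.powerset_cons, Multiset.filter_add, Multiset.card_add,
    Multiset.filter_map, Multiset.card_map]
  congr 3
  funext T
  simp [eq_sub_iff_add_eq, add_comm]

theorem nSub_pos_iff {S : Multiset G} {g : G} :
    0 < NSub S g ↔ ∃ T ≤ S, T.sum = g := by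
  simp [NSub, Multiset.card_pos_iff_exists_mem]

theorem nSub_eq_erase {S : Multiset G} {a : G} (ha : a ∈ S) (g : G) :
    NSub S g = NSub (S.erase a) g + NSub (S.erase a) (g - a) := by
  rw [← nSub_cons, Multiset.cons_erase ha]

theorem nSub_zero_pos (S : Multiset G) : 0 < NSub S 0 :=
  nSub_pos_iff.mpr ⟨0, Multiset.zero_le _, rfl⟩

/-- Negating the terms of a subsequence `U` translates the counting function by `U.sum`. -/
theorem nSub_map_neg_add (U V : Multiset G) (x : G) :
    NSub (U.map (fun g => -g) + V) x = NSub (U + V) (x + U.sum) := by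
  induction U using Multiset.induction_on generalizing x with
  | empty => simp
  | cons a U ih =>
    simp only [Multiset.map_cons, Multiset.cons_add, nSub_cons, Multiset.sum_cons, ih]
    rw [add_comm]
    congr 2 <;> abel

theorem nSub_erase_neg_pos {S T : Multiset G} {a : G} (hT : T ≤ S) (hsum : T.sum = 0)
    (ha : a ∈ T) : 0 < NSub (S.erase a) (0 - a) := by
  refine nSub_pos_iff.mpr ⟨T.erase a, Multiset.erase_le_erase a hT, ?_⟩
  rw [eq_sub_iff_add_eq, add_comm, Multiset.sum_erase ha, hsum]

variable [Fintype G]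

/-- Olson's bound: an element that is a subsequence sum of `S` is so at least
`2 ^ (|S| + 1 - D(G))` times. -/
theorem two_pow_le_nSub (S : Multiset G) (g : G) (hg : 0 < NSub S g) :
    2 ^ (Multiset.card S + 1 - Davenport G) ≤ NSub S g := by
  induction hn : Multiset.card S generalizing S g with
  | zero =>
    have := (davenport_spec G).1
    rw [Nat.sub_eq_zero_of_le (by omega)]
    rwa [pow_zero]
  | succ n ih =>
    by_cases hD : Davenport G ≤ n + 1
    · obtain ⟨U, hU, rfl⟩ := nSub_pos_iff.mp hg
      obtain ⟨V, rfl⟩ := Multiset.le_iff_exists_add.mp hU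
      have hflip := nSub_map_neg_add U V 0
      rw [zero_add] at hflip
      rw [← hflip]
      set R := U.map (fun g => -g) + V with hR
      have hcard : Multiset.card R = n + 1 := by simpa [hR] using hn
      obtain ⟨T, hT, hT0, hsum⟩ := (davenport_spec G).2 R (by omega)
      obtain ⟨a, ha⟩ := Multiset.exists_mem_of_ne_zero hT0
      have haR := Multiset.mem_of_le hT ha
      have hc : Multiset.card (R.erase a) = n := by
        rw [Multiset.card_erase_of_mem haR, hcard]; rfl
      have h1 := ih _ _ (nSub_zero_pos (R.erase a)) hc
      have h2 := ih _ _ (nSub_erase_neg_pos hT hsum ha) hc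
      rw [nSub_eq_erase haR, show n + 1 + 1 - Davenport G = (n + 1 - Davenport G) + 1 by omega,
        pow_succ]
      omega
    · rw [Nat.sub_eq_zero_of_le (by omega)]
      rwa [pow_zero]

/-- If `g ∈ E(S)` and both `g` and `g - a` are subsequence sums of `S·a⁻¹`, then both belong
to `E(S·a⁻¹)`. -/
theorem mem_eSet_erase {S : Multiset G} {a g : G} (hlen : Davenport G ≤ Multiset.card S)
    (ha : a ∈ S) (hg : g ∈ ESet S) (h1 : 0 < NSub (S.erase a) g)
    (h2 : 0 < NSub (S.erase a) (g - a)) :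
    g ∈ ESet (S.erase a) ∧ g - a ∈ ESet (S.erase a) := by
  have h1 := two_pow_le_nSub _ _ h1
  have h2 := two_pow_le_nSub _ _ h2
  have hc := Multiset.card_erase_add_one ha
  simp only [ESet, Set.mem_ofPred_eq] at hg ⊢
  rw [nSub_eq_erase ha, show Multiset.card S + 1 - Davenport G =
    (Multiset.card (S.erase a) + 1 - Davenport G) + 1 by omega, pow_succ] at hg
  omega

/-- If `0 ∈ E(S)`, then every element of `G` is a subsequence sum of `S`. -/
theorem nSub_pos_of_zero_mem_eSet (S : Multiset G)
    (hlen : Davenport G ≤ Multiset.card S + 1) (hE : (0 : G) ∈ ESet S) (g : G) :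
    0 < NSub S g := by
  induction hn : Multiset.card S using Nat.strong_induction_on generalizing S with | _ n ih
  by_cases hex : ∃ T : Multiset G, T ≤ S ∧ T ≠ 0 ∧ T.sum = 0
  · obtain ⟨T, hT, hT0, hsum⟩ := hex
    obtain ⟨a, ha⟩ := Multiset.exists_mem_of_ne_zero hT0
    have haS := Multiset.mem_of_le hT ha
    have hc := Multiset.card_erase_add_one haS
    have h1 := nSub_zero_pos (S.erase a)
    have h2 := nSub_erase_neg_pos hT hsum ha
    rcases hlen.lt_or_eq with hlt | heq
    · have h := ih _ (by omega) (S.erase a) (by omega)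
        (mem_eSet_erase (by omega) haS hE h1 h2).1 rfl
      rw [nSub_eq_erase haS]
      omega
    · simp only [ESet, Set.mem_ofPred_eq] at hE
      rw [nSub_eq_erase haS, heq, Nat.sub_self, pow_zero] at hE
      omega
  · obtain ⟨T, hT, hT0, hsum⟩ := (davenport_spec G).2 (-g ::ₘ S) (by simpa using hlen)
    have hmem : -g ∈ T := by
      by_contra hmem
      exact hex ⟨T, (Multiset.le_cons_of_notMem hmem).mp hT, hT0, hsum⟩
    refine nSub_pos_iff.mpr ⟨T.erase (-g), Multiset.erase_le_iff_le_cons.mpr hT, ?_⟩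
    have h := Multiset.sum_erase hmem
    rw [hsum, neg_add_eq_zero] at h
    exact h.symm

end SubsequenceCounts

theorem stmt4 {G : Type*} [AddCommGroup G] [Fintype G] [DecidableEq G]
    (S T : Multiset G) (a : G)
    (h0 : (0 : G) ∉ S) (hlen : Davenport G ≤ Multiset.card S)
    (hE : (0 : G) ∈ ESet S)
    (hT : T ≤ S) (hTne : T ≠ 0) (hTsum : T.sum = 0) (ha : a ∈ T) :
    ∀ h ∈ ESet S, h ∈ ESet (S.erase a) ∧ h - a ∈ ESet (S.erase a) := by
  intro h hh
  have haS := Multiset.mem_of_le hT ha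
  have hc := Multiset.card_erase_add_one haS
  have hE' := (mem_eSet_erase hlen haS hE (nSub_zero_pos _) (nSub_erase_neg_pos hT hTsum ha)).1
  have hpos := nSub_pos_of_zero_mem_eSet (S.erase a) (by omega) hE'
  exact mem_eSet_erase hlen haS hh (hpos h) (hpos (h - a))
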